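/- arXiv:2309.14679 — 4 statements merged into one kernel-verified Lean document; each statement's English description precedes it below -/
import Mathlib

section
/- Fix n ≥ 1 and let ω be the 1-form on ℝ^{n+1} dual to the rotation field X^⊤(x) = x₁e₂ − x₂e₁, i.e., ω_x(v) = x₁v₂ − x₂v₁. Define dω_x(v, w) = (fderiv ω x v)(w) − (fderiv ω x w)(v). Then ω ∧ dω = 0, i.e., for all x and all v₁, v₂, v₃ ∈ ℝ^{n+1}: ω_x(v₁)·dω_x(v₂, v₃) − ω_x(v₂)·dω_x(v₁, v₃) + ω_x(v₃)·dω_x(v₁, v₂) = 0. (This verifies the integrability condition (X^⊤)^♯ ∧ d((X^⊤)^♯) = 0, Assumption (viii), for the Euclidean rotation field, so that the distribution orthogonal to X^⊤ is integrable away from {X^⊤ = 0}.) -/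
open scoped RealInnerProductSpace

/-- The rotation form is linear in its base point, so it is its own derivative. -/
theorem fderiv_rotation_form {n : ℕ}
    (ω : EuclideanSpace ℝ (Fin (n + 1)) → (EuclideanSpace ℝ (Fin (n + 1)) →L[ℝ] ℝ))
    (hω : ∀ x v, ω x v = x 0 * v 1 - x 1 * v 0) (x v : EuclideanSpace ℝ (Fin (n + 1))) :
    fderiv ℝ ω x v = ω v := by
  have hlin : IsLinearMap ℝ ω :=
    { map_add := fun a b => by
        ext w
        simp only [add_apply, hω, PiLp.add_apply]
        ring
      map_smul := fun c a => by
        ext w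
        simp only [smul_apply, hω, PiLp.smul_apply, smul_eq_mul]
        ring }
  exact congrArg (· v) (LinearMap.toContinuousLinearMap hlin.mk').hasFDerivAt.fderiv

/-- The 1-form `ω_x(v) = x₁v₂ − x₂v₁` dual to the Euclidean rotation field
    satisfies the integrability condition `ω ∧ dω = 0`, where
    `dω_x(v, w) = (fderiv ω x v)(w) − (fderiv ω x w)(v)`. -/
theorem stmt_4 (n : ℕ) (hn : 1 ≤ n)
    (ω : EuclideanSpace ℝ (Fin (n + 1)) → (EuclideanSpace ℝ (Fin (n + 1)) →L[ℝ] ℝ))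
    (hω : ∀ x v, ω x v = x 0 * v 1 - x 1 * v 0) :
    ∀ (x v₁ v₂ v₃ : EuclideanSpace ℝ (Fin (n + 1))),
      ω x v₁ * ((fderiv ℝ ω x v₂) v₃ - (fderiv ℝ ω x v₃) v₂)
      - ω x v₂ * ((fderiv ℝ ω x v₁) v₃ - (fderiv ℝ ω x v₃) v₁)
      + ω x v₃ * ((fderiv ℝ ω x v₁) v₂ - (fderiv ℝ ω x v₂) v₁) = 0 := by
  intro x v₁ v₂ v₃
  simp only [fderiv_rotation_form ω hω, hω]
  ring
end

section
/- Define q : ℝ³ → ℝ by q(x) = (x₁ − 2)² + x₂² + x₃² and φ : ℝ³ \ {(2,0,0)} → ℝ by φ(x) = (4 − ‖x‖²)/q(x). Then for every x ≠ (2,0,0): φ(x)² − ⟨x, ∇φ(x)⟩ = (4 + ‖x‖²)/q(x), and in particular φ² − ⟨x, ∇φ⟩ > 0. (This verifies, for the example, the formula Λ = (φ² − X^⊥(φ))/φ³ of Proposition 2.2 together with the positivity Λ > 0 of Assumption (v), where X^⊥(x) = x is the dilation field and φ is its conformal factor for the metric g = e^{2f}·(Euclidean metric), f = −log q.) -/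
open scoped RealInnerProductSpace

/-- The derivative of a function along the dilation field is its derivative along rays. -/
lemma inner_gradient_self_eq_deriv_smul {E : Type*} [NormedAddCommGroup E]
    [InnerProductSpace ℝ E] [CompleteSpace E] {f : E → ℝ} {x : E}
    (hf : DifferentiableAt ℝ f x) :
    ⟪x, gradient f x⟫ = deriv (fun t : ℝ => f (t • x)) 1 := by
  have hray : HasDerivAt (fun t : ℝ => t • x) x 1 := by
    simpa using (hasDerivAt_id (1 : ℝ)).smul_const x
  have hf' : HasFDerivAt f (fderiv ℝ f x) ((1 : ℝ) • x) := by
    simpa using hf.hasFDerivAt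
  have h : deriv (fun t : ℝ => f (t • x)) 1 = fderiv ℝ f x x :=
    (hf'.comp_hasDerivAt (1 : ℝ) hray).deriv
  rw [h, real_inner_comm, gradient, InnerProductSpace.toDual_symm_apply]

/-- For `q(x) = (x₁−2)² + x₂² + x₃²` and the conformal factor
    `φ(x) = (4 − ‖x‖²)/q(x)` on `ℝ³ \ {(2,0,0)}`, one has
    `φ² − ⟨x, ∇φ⟩ = (4 + ‖x‖²)/q(x) > 0`. -/
theorem stmt_9
    (q : EuclideanSpace ℝ (Fin 3) → ℝ)
    (hq : ∀ x, q x = (x 0 - 2) ^ 2 + (x 1) ^ 2 + (x 2) ^ 2)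
    (φ : EuclideanSpace ℝ (Fin 3) → ℝ)
    (hφ : ∀ x, φ x = (4 - ‖x‖ ^ 2) / q x) :
    ∀ x : EuclideanSpace ℝ (Fin 3), x ≠ EuclideanSpace.single 0 (2 : ℝ) →
      φ x ^ 2 - ⟪x, gradient φ x⟫ = (4 + ‖x‖ ^ 2) / q x
      ∧ 0 < φ x ^ 2 - ⟪x, gradient φ x⟫ := by
  intro x hx
  have hqpos : 0 < q x := by
    rw [hq]
    by_contra hle
    apply hx
    have h0 : x 0 - 2 = 0 := by
      nlinarith [sq_nonneg (x 0 - 2), sq_nonneg (x 1), sq_nonneg (x 2)]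
    have h1 : x 1 = 0 := by
      nlinarith [sq_nonneg (x 0 - 2), sq_nonneg (x 1), sq_nonneg (x 2)]
    have h2 : x 2 = 0 := by
      nlinarith [sq_nonneg (x 0 - 2), sq_nonneg (x 1), sq_nonneg (x 2)]
    ext i
    fin_cases i
    · simpa using sub_eq_zero.mp h0
    · simpa using h1
    · simpa using h2
  have hqne : q x ≠ 0 := hqpos.ne'
  have hnorm : ∀ y : EuclideanSpace ℝ (Fin 3),
      ‖y‖ ^ 2 = y 0 ^ 2 + y 1 ^ 2 + y 2 ^ 2 := fun y => by
    rw [EuclideanSpace.real_norm_sq_eq, Fin.sum_univ_three]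
  have hφd : DifferentiableAt ℝ φ x := by
    have hqd : DifferentiableAt ℝ q x := by
      rw [funext hq]
      fun_prop
    rw [funext hφ]
    have hnum : DifferentiableAt ℝ (fun y : EuclideanSpace ℝ (Fin 3) => 4 - ‖y‖ ^ 2) x :=
      (differentiableAt_id.norm_sq ℝ).const_sub 4
    simpa only [div_eq_mul_inv] using hnum.fun_mul (hqd.fun_inv hqne)
  have hgrad : ⟪x, gradient φ x⟫ =
      (-(2 * ‖x‖ ^ 2) * q x - (4 - ‖x‖ ^ 2) * (2 * ‖x‖ ^ 2 - 4 * x 0)) / q x ^ 2 := by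
    rw [inner_gradient_self_eq_deriv_smul hφd]
    have hN : HasDerivAt (fun t : ℝ => 4 - t ^ 2 * ‖x‖ ^ 2) (-(2 * ‖x‖ ^ 2)) 1 := by
      simpa using (((hasDerivAt_id (1 : ℝ)).pow 2).mul_const (‖x‖ ^ 2)).const_sub 4
    have hD : HasDerivAt (fun t : ℝ => t ^ 2 * ‖x‖ ^ 2 - t * (4 * x 0) + 4)
        (2 * ‖x‖ ^ 2 - 4 * x 0) 1 := by
      simpa using ((((hasDerivAt_id (1 : ℝ)).pow 2).mul_const (‖x‖ ^ 2)).sub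
        ((hasDerivAt_id (1 : ℝ)).mul_const (4 * x 0))).add_const 4
    have hq1 : (1 : ℝ) ^ 2 * ‖x‖ ^ 2 - 1 * (4 * x 0) + 4 = q x := by
      rw [hq, hnorm]
      ring
    have hfun : (fun t : ℝ => φ (t • x)) =
        fun t : ℝ => (4 - t ^ 2 * ‖x‖ ^ 2) / (t ^ 2 * ‖x‖ ^ 2 - t * (4 * x 0) + 4) := by
      funext t
      rw [hφ, hq, hnorm, hnorm]
      simp only [PiLp.smul_apply, smul_eq_mul]
      congr 1 <;> ring
    rw [hfun]
    have h := (hN.fun_div hD (by rwa [hq1])).deriv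
    rw [hq1] at h
    rw [h]
    ring
  have hmain : φ x ^ 2 - ⟪x, gradient φ x⟫ = (4 + ‖x‖ ^ 2) / q x := by
    have hx0 : 2 * ‖x‖ ^ 2 - 4 * x 0 = q x - (4 - ‖x‖ ^ 2) := by
      rw [hq, hnorm]
      ring
    rw [hgrad, hφ, hx0]
    field_simp
    ring
  refine ⟨hmain, ?_⟩
  rw [hmain]
  positivity
end

section
/- Define q : ℝ³ → ℝ by q(x) = (x₁ − 2)² + x₂² + x₃² and let ω be the 1-form on ℝ³ \ {(2,0,0)} given by ω_x(v) = ⟨x, v⟩/q(x)² (this is the g-dual (X^⊥)^♭ = e^{2f}⟨x, ·⟩ of the position field for the metric g = e^{2f}·(Euclidean metric), f = −log q). Then ω is not closed on the region U = {x : 0 < ‖x‖ < 2}: there exist x ∈ U and v, w ∈ ℝ³ such that (fderiv ω x v)(w) ≠ (fderiv ω x w)(v). (This is the paper's verification d((X^⊥)^♭) ≠ 0, showing the conformal Killing field of the example is not closed and hence cannot be obtained from a warped-product structure.) -/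
open scoped RealInnerProductSpace

/-- The derivative of the `1`-form `x ↦ c x • ⟪x, ·⟫`. -/
theorem fderiv_smul_innerSL_apply {E : Type*} [NormedAddCommGroup E] [InnerProductSpace ℝ E]
    {c : E → ℝ} {c' : E →L[ℝ] ℝ} {x : E} (hc : HasFDerivAt c c' x) (v w : E) :
    fderiv ℝ (fun y => c y • innerSL ℝ y) x v w = c x * ⟪v, w⟫ + c' v * ⟪x, w⟫ := by
  have h : HasFDerivAt (fun y : E => innerSL ℝ y) (innerSL ℝ : E →L[ℝ] E →L[ℝ] ℝ) x :=
    (innerSL ℝ : E →L[ℝ] E →L[ℝ] ℝ).hasFDerivAt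
  rw [(hc.fun_smul h).fderiv]
  simp only [add_apply, smul_apply, ContinuousLinearMap.smulRight_apply, innerSL_apply_apply, smul_eq_mul]
  rfl

/-- The 1-form `ω_x(v) = ⟨x, v⟩/q(x)²` (the `g`-dual of the position field for
    the conformally flat metric `g = e^{2f}·euclidean`, `f = −log q`) is not
    closed on the region `{0 < ‖x‖ < 2}`: its derivative fails to be symmetric
    somewhere. -/
theorem stmt_11
    (q : EuclideanSpace ℝ (Fin 3) → ℝ)
    (hq : ∀ x, q x = (x 0 - 2) ^ 2 + (x 1) ^ 2 + (x 2) ^ 2)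
    (ω : EuclideanSpace ℝ (Fin 3) → (EuclideanSpace ℝ (Fin 3) →L[ℝ] ℝ))
    (hω : ∀ x v, ω x v = ⟪x, v⟫ / (q x) ^ 2) :
    ∃ (x v w : EuclideanSpace ℝ (Fin 3)),
      0 < ‖x‖ ∧ ‖x‖ < 2 ∧ (fderiv ℝ ω x v) w ≠ (fderiv ℝ ω x w) v := by
  have hω' : ω = fun y => ((q y) ^ 2)⁻¹ • innerSL ℝ y := by
    ext y v
    simp [hω, div_eq_inv_mul]
  let e : Fin 3 → EuclideanSpace ℝ (Fin 3) := fun i => EuclideanSpace.single i 1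
  have hproj (i : Fin 3) : HasFDerivAt (fun y : EuclideanSpace ℝ (Fin 3) => y i)
      (EuclideanSpace.proj i : EuclideanSpace ℝ (Fin 3) →L[ℝ] ℝ) (e 1) :=
    (EuclideanSpace.proj i : EuclideanSpace ℝ (Fin 3) →L[ℝ] ℝ).hasFDerivAt
  have hqd := ((HasFDerivAt.pow ((hproj 0).sub_const 2) 2).fun_add (HasFDerivAt.pow (hproj 1) 2)).fun_add
    (HasFDerivAt.pow (hproj 2) 2)
  rw [← funext hq] at hqd
  have h21 : (2 : Fin 3) ≠ 1 := by decide
  have hqe : q (e 1) = 5 := by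
    norm_num [hq, e, h21]
  have hc : HasFDerivAt (fun y => (q y ^ 2)⁻¹) _ (e 1) :=
    (hasDerivAt_inv (x := q (e 1) ^ 2) (by norm_num [hqe])).comp_hasFDerivAt (e 1)
      (HasFDerivAt.pow hqd 2)
  refine ⟨e 1, e 0, e 1, by simp [e], by simp [e], ?_⟩
  rw [hω', fderiv_smul_innerSL_apply hc, fderiv_smul_innerSL_apply hc]
  norm_num [hqe, e, h21, EuclideanSpace.inner_single_left]
end

section
/- Let n ≥ 1, let a > 0 and K > 0 be real numbers, and define F : ℝⁿ → ℝⁿ by F(p) = √K · (1 + a‖p‖²)^{−1/2} · p. Then F is differentiable, its derivative is (fderiv F p)(v) = √K·(1 + a‖p‖²)^{−1/2}·v − √K·a·(1 + a‖p‖²)^{−3/2}·⟨p, v⟩·p, and it is elliptic with explicit two-sided bounds: for all p, v ∈ ℝⁿ, √K·(1 + a‖p‖²)^{−3/2}·‖v‖² ≤ ⟨(fderiv F p)(v), v⟩ ≤ √K·(1 + a‖p‖²)^{−1/2}·‖v‖². (This is the uniform ellipticity of the flux A^i(x,z,p) = √(G^{n−2}/(1 + (H/G)|p|²))·p_i of the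 graphical flow equation established in the Appendix, with K = G^{n−2} and a = H/G; together with the gradient bound it makes the flow uniformly parabolic.) -/
open scoped RealInnerProductSpace

theorem one_add_mul_norm_sq_pos {E : Type*} [SeminormedAddCommGroup E] {a : ℝ} (ha : 0 < a)
    (p : E) : 0 < 1 + a * ‖p‖ ^ 2 := by
  positivity

section Flux

variable {E : Type*} [NormedAddCommGroup E] [InnerProductSpace ℝ E]

theorem hasFDerivAt_flux {a : ℝ} (ha : 0 < a) (c : ℝ) (p : E) :
    HasFDerivAt (fun q : E => (c * (1 + a * ‖q‖ ^ 2) ^ (-(1 : ℝ) / 2)) • q)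
      ((c * (1 + a * ‖p‖ ^ 2) ^ (-(1 : ℝ) / 2)) • ContinuousLinearMap.id ℝ E
        - (((c * a * (1 + a * ‖p‖ ^ 2) ^ (-(3 : ℝ) / 2)) • innerSL ℝ p).smulRight p)) p := by
  have hu : HasFDerivAt (fun q : E => 1 + a * ‖q‖ ^ 2) (a • (2 • innerSL ℝ p)) p :=
    ((hasStrictFDerivAt_norm_sq p).hasFDerivAt.const_mul a).const_add 1
  have hr := ((hu.rpow_const (p := -(1 : ℝ) / 2)
    (Or.inl (one_add_mul_norm_sq_pos ha p).ne')).const_mul c).smul (hasFDerivAt_id p)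
  refine hr.congr_fderiv ?_
  ext v
  have he : (-(1 : ℝ) / 2 - 1) = -(3 : ℝ) / 2 := by norm_num
  simp only [he, id, add_apply, sub_apply,
    smul_apply, ContinuousLinearMap.smulRight_apply,
    ContinuousLinearMap.id_apply, innerSL_apply_apply, smul_eq_mul, nsmul_eq_mul]
  module

theorem flux_elliptic {a c : ℝ} (ha : 0 < a) (hc : 0 ≤ c) (p v : E) :
    c * (1 + a * ‖p‖ ^ 2) ^ (-(3 : ℝ) / 2) * ‖v‖ ^ 2
        ≤ ⟪(c * (1 + a * ‖p‖ ^ 2) ^ (-(1 : ℝ) / 2)) • v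
            - (c * a * (1 + a * ‖p‖ ^ 2) ^ (-(3 : ℝ) / 2) * ⟪p, v⟫) • p, v⟫
      ∧ ⟪(c * (1 + a * ‖p‖ ^ 2) ^ (-(1 : ℝ) / 2)) • v
            - (c * a * (1 + a * ‖p‖ ^ 2) ^ (-(3 : ℝ) / 2) * ⟪p, v⟫) • p, v⟫
        ≤ c * (1 + a * ‖p‖ ^ 2) ^ (-(1 : ℝ) / 2) * ‖v‖ ^ 2 := by
  have hu := one_add_mul_norm_sq_pos ha p
  have hw : (1 + a * ‖p‖ ^ 2) ^ (-(1 : ℝ) / 2)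
      = (1 + a * ‖p‖ ^ 2) ^ (-(3 : ℝ) / 2) * (1 + a * ‖p‖ ^ 2) := by
    rw [← Real.rpow_add_one hu.ne']
    norm_num
  have hcs : ⟪p, v⟫ ^ 2 ≤ ‖p‖ ^ 2 * ‖v‖ ^ 2 := by
    rw [← mul_pow]
    exact sq_le_sq' (neg_le_of_abs_le (abs_real_inner_le_norm p v)) (real_inner_le_norm p v)
  have hd : 0 ≤ c * a * (1 + a * ‖p‖ ^ 2) ^ (-(3 : ℝ) / 2) := by positivity
  rw [inner_sub_left, real_inner_smul_left, real_inner_smul_left, real_inner_self_eq_norm_sq]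
  constructor
  · rw [hw]
    linear_combination mul_le_mul_of_nonneg_left hcs hd
  · linear_combination mul_nonneg hd (sq_nonneg ⟪p, v⟫)

end Flux

/-- The flux `F(p) = √K·(1 + a‖p‖²)^{-1/2}·p` of the graphical flow is
    differentiable, its derivative is
    `DF_p(v) = √K(1+a‖p‖²)^{-1/2} v − √K a (1+a‖p‖²)^{-3/2} ⟨p,v⟩ p`,
    and it is uniformly elliptic:
    `√K(1+a‖p‖²)^{-3/2}‖v‖² ≤ ⟨DF_p(v), v⟩ ≤ √K(1+a‖p‖²)^{-1/2}‖v‖²`. -/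
theorem stmt_17 (n : ℕ) (hn : 1 ≤ n) (a K : ℝ) (ha : 0 < a) (hK : 0 < K)
    (F : EuclideanSpace ℝ (Fin n) → EuclideanSpace ℝ (Fin n))
    (hF : ∀ p, F p = (Real.sqrt K * (1 + a * ‖p‖ ^ 2) ^ (-(1 : ℝ) / 2)) • p) :
    Differentiable ℝ F
    ∧ (∀ p v : EuclideanSpace ℝ (Fin n),
        (fderiv ℝ F p) v
          = (Real.sqrt K * (1 + a * ‖p‖ ^ 2) ^ (-(1 : ℝ) / 2)) • v
            - (Real.sqrt K * a * (1 + a * ‖p‖ ^ 2) ^ (-(3 : ℝ) / 2) * ⟪p, v⟫) • p)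
    ∧ (∀ p v : EuclideanSpace ℝ (Fin n),
        Real.sqrt K * (1 + a * ‖p‖ ^ 2) ^ (-(3 : ℝ) / 2) * ‖v‖ ^ 2
            ≤ ⟪(fderiv ℝ F p) v, v⟫
        ∧ ⟪(fderiv ℝ F p) v, v⟫
            ≤ Real.sqrt K * (1 + a * ‖p‖ ^ 2) ^ (-(1 : ℝ) / 2) * ‖v‖ ^ 2) := by
  obtain rfl : F = fun p => (Real.sqrt K * (1 + a * ‖p‖ ^ 2) ^ (-(1 : ℝ) / 2)) • p := funext hF
  have hD : ∀ p v : EuclideanSpace ℝ (Fin n),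
      (fderiv ℝ (fun p => (Real.sqrt K * (1 + a * ‖p‖ ^ 2) ^ (-(1 : ℝ) / 2)) • p) p) v
        = (Real.sqrt K * (1 + a * ‖p‖ ^ 2) ^ (-(1 : ℝ) / 2)) • v
          - (Real.sqrt K * a * (1 + a * ‖p‖ ^ 2) ^ (-(3 : ℝ) / 2) * ⟪p, v⟫) • p := by
    intro p v
    rw [(hasFDerivAt_flux ha (Real.sqrt K) p).fderiv]
    simp
  refine ⟨fun p => (hasFDerivAt_flux ha (Real.sqrt K) p).differentiableAt, hD, fun p v => ?_⟩
  rw [hD]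
  exact flux_elliptic ha (Real.sqrt_nonneg K) p v
end
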